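/- arXiv:1201.4993 — 7 statements merged into one kernel-verified Lean document; each statement's English description precedes it below -/
import Mathlib

section
/- Let m, k ≥ 1, ρ > 0, λ ≥ 0 and set δ = ρ/(3(1+λ)). Let M be a topological space, f : M → ℝ^{m+k} continuous, and p, q ∈ M. Let A_p, A_q be affine Euclidean isometries of ℝ^{m+k} with A_p(0) = f(p) and A_q(0) = f(q), and let π : ℝ^{m+k} → ℝ^m be the projection onto the first m coordinates. For σ > 0 let U_{σ,p} denote the connected component of p in (π ∘ A_p⁻¹ ∘ f)⁻¹(B_σ), and define U_{σ,q} analogously. Assume A_p⁻¹(f(U_{δ,p})) = {(x, u_p(x)) : x ∈ B_δ} and A_q⁻¹(f(U_{δ,q})) = {(x, u_q(x)) : x ∈ B_δ} for λ-Lipschitz functions u_p, u_q : B_δ → ℝ^k. If U_{δ,q} ∩ U_{δ,p} ≠ ∅, then U_{δ,p} ⊆ U_{ρ,q}. -/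
open Metric

/-- If `f` has `λ`-Lipschitz graph representations of radius
`δ = ρ/(3(1+λ))` around both `p` and `q` (over the isometries `A_p`, `A_q`), and the
corresponding components `U_{δ,p}` and `U_{δ,q}` intersect, then `U_{δ,p} ⊆ U_{ρ,q}`. -/
theorem stmt_1 {m k : ℕ} (hm : 1 ≤ m) (hk : 1 ≤ k) (ρ lam δ : ℝ) (hρ : 0 < ρ) (hlam : 0 ≤ lam)
    (hδ : δ = ρ / (3 * (1 + lam)))
    {M : Type*} [TopologicalSpace M]
    (f : M → WithLp 2 (EuclideanSpace ℝ (Fin m) × EuclideanSpace ℝ (Fin k)))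
    (hf : Continuous f) (p q : M)
    (Ap Aq : WithLp 2 (EuclideanSpace ℝ (Fin m) × EuclideanSpace ℝ (Fin k)) ≃ᵢ
         WithLp 2 (EuclideanSpace ℝ (Fin m) × EuclideanSpace ℝ (Fin k)))
    (hAp0 : Ap 0 = f p) (hAq0 : Aq 0 = f q)
    (Up Uq : ℝ → Set M)
    (hUp : ∀ σ : ℝ, Up σ = connectedComponentIn
      ((fun z => ((WithLp.equiv 2 (EuclideanSpace ℝ (Fin m) × EuclideanSpace ℝ (Fin k)))
          (Ap.symm (f z))).1) ⁻¹' ball (0 : EuclideanSpace ℝ (Fin m)) σ) p)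
    (hUq : ∀ σ : ℝ, Uq σ = connectedComponentIn
      ((fun z => ((WithLp.equiv 2 (EuclideanSpace ℝ (Fin m) × EuclideanSpace ℝ (Fin k)))
          (Aq.symm (f z))).1) ⁻¹' ball (0 : EuclideanSpace ℝ (Fin m)) σ) q)
    (up uq : EuclideanSpace ℝ (Fin m) → EuclideanSpace ℝ (Fin k))
    (hup : ∀ x ∈ ball (0 : EuclideanSpace ℝ (Fin m)) δ,
      ∀ y ∈ ball (0 : EuclideanSpace ℝ (Fin m)) δ, ‖up x - up y‖ ≤ lam * ‖x - y‖)
    (huq : ∀ x ∈ ball (0 : EuclideanSpace ℝ (Fin m)) δ,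
      ∀ y ∈ ball (0 : EuclideanSpace ℝ (Fin m)) δ, ‖uq x - uq y‖ ≤ lam * ‖x - y‖)
    (hgraphp : Ap.symm '' (f '' Up δ) =
      (fun x => (WithLp.equiv 2 (EuclideanSpace ℝ (Fin m) × EuclideanSpace ℝ (Fin k))).symm
        (x, up x)) '' ball (0 : EuclideanSpace ℝ (Fin m)) δ)
    (hgraphq : Aq.symm '' (f '' Uq δ) =
      (fun x => (WithLp.equiv 2 (EuclideanSpace ℝ (Fin m) × EuclideanSpace ℝ (Fin k))).symm
        (x, uq x)) '' ball (0 : EuclideanSpace ℝ (Fin m)) δ)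
    (hinter : (Uq δ ∩ Up δ).Nonempty) :
    Up δ ⊆ Uq ρ := by
  have h1l : 0 < 1 + lam := by linarith
  have hδm : δ * (3 * (1 + lam)) = ρ := by rw [hδ]; field_simp
  have hδ0 : 0 < δ := by rw [hδ]; positivity
  have hδρ : 3 * δ ≤ ρ := by nlinarith [mul_nonneg hδ0.le hlam]
  obtain ⟨r, hrq, hrp⟩ := hinter
  have hsubq : ∀ z ∈ Uq δ, ‖(Aq.symm (f z)).fst‖ < δ := by
    intro z hz
    rw [hUq] at hz
    have := connectedComponentIn_subset _ _ hz
    simpa using this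
  have hmono : Uq δ ⊆ Uq ρ := by
    rw [hUq, hUq]
    exact connectedComponentIn_mono _ (Set.preimage_mono (ball_subset_ball (by linarith)))
  have key : ∀ z ∈ Up δ, ‖(Aq.symm (f z)).fst‖ < ρ := by
    intro z hz
    have hz' : Ap.symm (f z) ∈ Ap.symm '' (f '' Up δ) := ⟨_, ⟨z, hz, rfl⟩, rfl⟩
    have hr' : Ap.symm (f r) ∈ Ap.symm '' (f '' Up δ) := ⟨_, ⟨r, hrp, rfl⟩, rfl⟩
    rw [hgraphp] at hz' hr'
    obtain ⟨x, hx, hxz⟩ := hz'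
    obtain ⟨y, hy, hyr⟩ := hr'
    have hu := hup x hx y hy
    have hxy : ‖x - y‖ < 2 * δ := by
      have := norm_sub_le x y
      rw [mem_ball_zero_iff] at hx hy
      linarith
    have hd : dist (f z) (f r) ≤ ‖x - y‖ + ‖up x - up y‖ := by
      rw [← Ap.symm.dist_eq, ← hxz, ← hyr, dist_eq_norm, WithLp.prod_norm_eq_of_L2]
      apply Real.sqrt_le_iff.2
      refine ⟨by positivity, ?_⟩
      have h1 := norm_nonneg (x - y)
      have h2 := norm_nonneg (up x - up y)
      simp only [WithLp.equiv_symm_apply, WithLp.sub_fst, WithLp.sub_snd]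
      change ‖x - y‖ ^ 2 + ‖up x - up y‖ ^ 2 ≤ _
      nlinarith [mul_nonneg h1 h2]
    have hfst : ‖(Aq.symm (f z) - Aq.symm (f r)).fst‖ ≤ dist (f z) (f r) := by
      rw [← Aq.symm.dist_eq, dist_eq_norm]
      rw [WithLp.prod_norm_eq_of_L2]
      apply Real.le_sqrt_of_sq_le
      nlinarith [sq_nonneg ‖(Aq.symm (f z) - Aq.symm (f r)).snd‖]
    have hr2 := hsubq r hrq
    rw [WithLp.sub_fst] at hfst
    have ht := norm_sub_norm_le (Aq.symm (f z)).fst (Aq.symm (f r)).fst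
    have hb : (1 + lam) * ‖x - y‖ < (1 + lam) * (2 * δ) := mul_lt_mul_of_pos_left hxy h1l
    nlinarith
  have hrρ : r ∈ Uq ρ := hmono hrq
  have hpre : IsPreconnected (Up δ) := by
    rw [hUp]; exact isPreconnected_connectedComponentIn
  rw [hUq] at hrρ ⊢
  rw [connectedComponentIn_eq hrρ]
  refine hpre.subset_connectedComponentIn hrp ?_
  intro z hz
  simpa using key z hz
end

section
/- Let n ≥ 1, δ > 0, and let g : ℝ → ℝ satisfy 0 ≤ g ≤ 1, |g(s) − g(t)| ≤ 2|s − t| for all s, t, and g(t) = 0 for t ≥ 1. Let a₁, …, a_s ∈ ℝ^n be points, ν₁, …, ν_s ∈ ℝ^n unit vectors, and let A ⊆ ℝ^n and N ∈ ℕ be such that every x ∈ A satisfies |{k : |x − a_k| < δ}| ≤ N. Define S : A → ℝ^n by S(x) = Σ_{k=1}^s g(|x − a_k|/δ) ν_k. Then S is Lipschitz on A with Lipschitz constant 4N/δ, i.e. |S(x) − S(y)| ≤ (4N/δ)|x − y| for all x, y ∈ A. -/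
open Metric

/-- The averaged field `S(x) = Σ_k g(|x - a_k|/δ) ν_k` built from a
`2`-Lipschitz cutoff `g` with `0 ≤ g ≤ 1` vanishing on `[1, ∞)`, unit vectors `ν_k`, and a
family of points `a_k` such that every `x ∈ A` has at most `N` of the `a_k` within distance
`δ`, is Lipschitz on `A` with constant `4N/δ`. -/
theorem stmt_6 {n : ℕ} (hn : 1 ≤ n) (δ : ℝ) (hδ : 0 < δ)
    (g : ℝ → ℝ) (hg0 : ∀ t, 0 ≤ g t) (hg1 : ∀ t, g t ≤ 1)
    (hglip : ∀ s t : ℝ, |g s - g t| ≤ 2 * |s - t|)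
    (hgvan : ∀ t : ℝ, 1 ≤ t → g t = 0)
    (s : ℕ) (a : Fin s → EuclideanSpace ℝ (Fin n))
    (ν : Fin s → EuclideanSpace ℝ (Fin n)) (hν : ∀ j, ‖ν j‖ = 1)
    (A : Set (EuclideanSpace ℝ (Fin n))) (N : ℕ)
    (hN : ∀ x ∈ A, ({j : Fin s | ‖x - a j‖ < δ}).ncard ≤ N)
    (S : EuclideanSpace ℝ (Fin n) → EuclideanSpace ℝ (Fin n))
    (hS : ∀ x, S x = ∑ j, g (‖x - a j‖ / δ) • ν j) :
    ∀ x ∈ A, ∀ y ∈ A, ‖S x - S y‖ ≤ (4 * N / δ) * ‖x - y‖ := by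
  classical
  intro x hx y hy
  have hsum : ∀ z ∈ A, (∑ j, (if ‖z - a j‖ < δ then (1 : ℝ) else 0)) ≤ N := by
    intro z hz
    have h := hN z hz
    rw [Set.ncard_eq_toFinset_card', Set.toFinset_setOf] at h
    rw [Finset.sum_boole]
    exact_mod_cast h
  have hvan : ∀ z : EuclideanSpace ℝ (Fin n), ∀ j, ¬ ‖z - a j‖ < δ → g (‖z - a j‖ / δ) = 0 := by
    intro z j h
    exact hgvan _ ((one_le_div hδ).2 (not_lt.1 h))
  have hc : 0 ≤ 2 / δ * ‖x - y‖ := by positivity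
  have hterm : ∀ j, ‖g (‖x - a j‖ / δ) • ν j - g (‖y - a j‖ / δ) • ν j‖ ≤
      2 / δ * ‖x - y‖ * ((if ‖x - a j‖ < δ then (1 : ℝ) else 0)
        + (if ‖y - a j‖ < δ then (1 : ℝ) else 0)) := by
    intro j
    rw [← sub_smul, norm_smul, hν, mul_one, Real.norm_eq_abs]
    have hb : |g (‖x - a j‖ / δ) - g (‖y - a j‖ / δ)| ≤ 2 / δ * ‖x - y‖ := by
      refine (hglip _ _).trans ?_
      rw [← sub_div, abs_div, abs_of_pos hδ]
      have h := abs_norm_sub_norm_le (x - a j) (y - a j)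
      rw [sub_sub_sub_cancel_right] at h
      calc 2 * (|‖x - a j‖ - ‖y - a j‖| / δ) ≤ 2 * (‖x - y‖ / δ) := by gcongr
        _ = _ := by ring
    by_cases h1 : ‖x - a j‖ < δ
    · by_cases h2 : ‖y - a j‖ < δ
      · simp only [h1, h2, if_true]; linarith
      · simp only [h1, h2, if_true, if_false]; linarith
    · by_cases h2 : ‖y - a j‖ < δ
      · simp only [h1, h2, if_true, if_false]; linarith
      · simp [h1, h2, hvan x j h1, hvan y j h2]
  rw [hS, hS, ← Finset.sum_sub_distrib]
  refine (norm_sum_le _ _).trans ((Finset.sum_le_sum fun j _ => hterm j).trans ?_)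
  rw [← Finset.mul_sum, Finset.sum_add_distrib]
  calc _ ≤ 2 / δ * ‖x - y‖ * ((N : ℝ) + N) :=
        mul_le_mul_of_nonneg_left (add_le_add (hsum x hx) (hsum y hy)) hc
    _ = _ := by ring
end

section
/- Let m ≥ 1, ρ > 0 and 0 ≤ γ < π/2. Let u : B_ρ → ℝ be differentiable, and for q ∈ B_ρ let ν(q) = (1 + |∇u(q)|²)^{-1/2} · (−∇u(q), 1) ∈ ℝ^m × ℝ be the upward unit normal to the graph of u at q. Let T : B_ρ → ℝ^{m+1} satisfy |T(p)| = 1 and ⟨T(p), ν(q)⟩ ≥ cos γ for all p, q ∈ B_ρ. Then for all x, y ∈ B_ρ, the Euclidean distance from the point (x, u(x)) to the line {(y, u(y)) + t·T(y) : t ∈ ℝ} is at least |x − y|·cos γ. -/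
open Metric
open scoped RealInnerProductSpace

/-- If `T` is a unit vector field on `B_ρ` making an angle of at most
`γ < π/2` with every upward unit normal `ν(q)` of the graph of the differentiable function
`u : B_ρ → ℝ` (i.e. `⟪T p, ν q⟫ ≥ cos γ`), then for `x, y ∈ B_ρ` the distance from the graph
point `(x, u x)` to the line `{(y, u y) + t • T y}` is at least `|x - y| cos γ`. -/
theorem stmt_8 {m : ℕ} (hm : 1 ≤ m) (ρ γ : ℝ) (hρ : 0 < ρ) (hγ0 : 0 ≤ γ)
    (hγ : γ < Real.pi / 2)
    (u : EuclideanSpace ℝ (Fin m) → ℝ)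
    (hdiff : ∀ q ∈ ball (0 : EuclideanSpace ℝ (Fin m)) ρ, DifferentiableAt ℝ u q)
    (ν : EuclideanSpace ℝ (Fin m) → WithLp 2 (EuclideanSpace ℝ (Fin m) × ℝ))
    (hν : ∀ q ∈ ball (0 : EuclideanSpace ℝ (Fin m)) ρ,
      ν q = (Real.sqrt (1 + ‖gradient u q‖ ^ 2))⁻¹ •
        (WithLp.equiv 2 (EuclideanSpace ℝ (Fin m) × ℝ)).symm (-(gradient u q), 1))
    (T : EuclideanSpace ℝ (Fin m) → WithLp 2 (EuclideanSpace ℝ (Fin m) × ℝ))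
    (hT1 : ∀ p ∈ ball (0 : EuclideanSpace ℝ (Fin m)) ρ, ‖T p‖ = 1)
    (hTν : ∀ p ∈ ball (0 : EuclideanSpace ℝ (Fin m)) ρ,
      ∀ q ∈ ball (0 : EuclideanSpace ℝ (Fin m)) ρ, Real.cos γ ≤ ⟪T p, ν q⟫) :
    ∀ x ∈ ball (0 : EuclideanSpace ℝ (Fin m)) ρ, ∀ y ∈ ball (0 : EuclideanSpace ℝ (Fin m)) ρ,
      ∀ t : ℝ, ‖x - y‖ * Real.cos γ ≤
        ‖(WithLp.equiv 2 (EuclideanSpace ℝ (Fin m) × ℝ)).symm (x, u x) -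
          ((WithLp.equiv 2 (EuclideanSpace ℝ (Fin m) × ℝ)).symm (y, u y) + t • T y)‖ := by
  intro x hx y hy t
  obtain ⟨z, hz, hzu⟩ := domain_mvt (f := u) (f' := fun q => fderiv ℝ u q)
    (fun q hq => (hdiff q hq).hasFDerivAt.hasFDerivWithinAt) (convex_ball 0 ρ) hy hx
  have hzb := (convex_ball (0 : EuclideanSpace ℝ (Fin m)) ρ).segment_subset hy hx hz
  have hg : ⟪gradient u z, x - y⟫ = u x - u y := by
    rw [hzu]; simp [gradient]
  have hcos : 0 ≤ Real.cos γ :=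
    Real.cos_nonneg_of_mem_Icc ⟨by linarith [Real.pi_pos], hγ.le⟩
  have hpos : (0:ℝ) < 1 + ‖gradient u z‖ ^ 2 := by positivity
  set c : WithLp 2 (EuclideanSpace ℝ (Fin m) × ℝ) :=
    (WithLp.equiv 2 (EuclideanSpace ℝ (Fin m) × ℝ)).symm (x, u x) -
      (WithLp.equiv 2 (EuclideanSpace ℝ (Fin m) × ℝ)).symm (y, u y) with hc
  have hnc : ⟪ν z, c⟫ = 0 := by
    rw [hν z hzb, inner_smul_left, hc, WithLp.prod_inner_apply]
    simp [inner_neg_left, hg]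
  have hn1 : ‖ν z‖ ^ 2 = 1 := by
    rw [hν z hzb, norm_smul, mul_pow, WithLp.prod_norm_sq_eq_of_L2]
    simp only [norm_inv, inv_pow, Real.norm_eq_abs, sq_abs, Real.sq_sqrt hpos.le]
    simp only [WithLp.equiv_symm_apply, norm_neg, norm_one]
    rw [inv_mul_eq_one₀ hpos.ne']
    simp [add_comm]
  have hcx : ‖x - y‖ ^ 2 ≤ ‖c‖ ^ 2 := by
    rw [WithLp.prod_norm_sq_eq_of_L2]
    have h0 : c.fst = x - y := rfl
    rw [h0]
    nlinarith [sq_nonneg ‖c.snd‖]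
  have hT := hT1 y hy
  have ha := hTν y hy z hzb
  set a := ⟪T y, ν z⟫ with hadef
  have h1 : ‖T y - a • ν z‖ ^ 2 = 1 - a ^ 2 := by
    rw [norm_sub_sq_real, norm_smul, mul_pow, hn1, hT, inner_smul_right, ← hadef,
      Real.norm_eq_abs, sq_abs]
    ring
  have h2 : ⟪T y - a • ν z, c⟫ = ⟪T y, c⟫ := by
    rw [inner_sub_left, inner_smul_left, hnc]; simp
  have h3 : ⟪T y, c⟫ ^ 2 ≤ (1 - a ^ 2) * ‖c‖ ^ 2 := by
    rw [← h1, ← h2, ← mul_pow, ← sq_abs]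
    exact pow_le_pow_left₀ (abs_nonneg _) (abs_real_inner_le_norm _ _) 2
  rw [← sub_sub, ← hc]
  refine (sq_le_sq₀ (by positivity) (norm_nonneg _)).1 ?_
  rw [norm_sub_sq_real, norm_smul, mul_pow, hT, inner_smul_right, real_inner_comm,
    Real.norm_eq_abs, mul_pow, sq_abs]
  have h4 : Real.cos γ ^ 2 ≤ a ^ 2 := pow_le_pow_left₀ hcos ha 2
  have h5 : ‖x - y‖ ^ 2 * Real.cos γ ^ 2 ≤ ‖c‖ ^ 2 * a ^ 2 := by gcongr
  nlinarith [sq_nonneg (t - ⟪T y, c⟫)]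
end

section
/- Let m ≥ 1, ρ > 0, 0 < L < ∞ and 0 ≤ γ < π/2. Let u : B_ρ → ℝ be differentiable, and for q ∈ B_ρ let ν(q) = (1 + |∇u(q)|²)^{-1/2} · (−∇u(q), 1) ∈ ℝ^m × ℝ be the upward unit normal to the graph of u at q. Let T : B_ρ → ℝ^{m+1} be L-Lipschitz with |T(p)| = 1 and ⟨T(p), ν(q)⟩ ≥ cos γ for all p, q ∈ B_ρ. Set ε = (cos γ)/L and define F : B_ρ × (−ε, ε) → ℝ^{m+1} by F(x, t) = (x, u(x)) + t·T(x). Then F is injective; consequently (by invariance of domain) F maps B_ρ × (−ε, ε) homeomorphically onto an open neighborhood of the graph {(x, u(x)) : x ∈ B_ρ} in ℝ^{m+1}. -/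
open Metric
open scoped RealInnerProductSpace


lemma tub_proj {E : Type*} [NormedAddCommGroup E] [InnerProductSpace ℝ E] (n e z : E) (σ c : ℝ)
    (hc : 0 < c) (hn : ‖n‖ = 1) (he : ‖e‖ = 1) (hen : c ≤ ⟪e, n⟫) (h : ⟪z + σ • e, n⟫ = 0) :
    c * ‖z + σ • e‖ ≤ ‖z‖ ∧ c * |σ| ≤ ‖z‖ := by
  set w := z + σ • e with hw
  set a := ⟪e, n⟫ with ha
  have hz : z = w - σ • e := by rw [hw]; abel
  constructor
  · have h1 : ‖z‖ ^ 2 = ‖w‖ ^ 2 - 2 * (σ * ⟪w, e⟫) + σ ^ 2 := by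
      rw [hz, norm_sub_sq_real, inner_smul_right, norm_smul, he]; simp
    have h2 : ⟪w, e⟫ = ⟪w, e - a • n⟫ := by
      rw [inner_sub_right, inner_smul_right, h]; ring
    have h3 : ‖e - a • n‖ ^ 2 = 1 - a ^ 2 := by
      rw [norm_sub_sq_real, inner_smul_right, norm_smul, he, hn, ← ha]; simp; ring
    have h4 : ⟪w, e⟫ ^ 2 ≤ ‖w‖ ^ 2 * (1 - a ^ 2) := by
      rw [h2, ← h3, ← mul_pow]
      exact sq_le_sq' (neg_le_of_abs_le (abs_real_inner_le_norm _ _)) (real_inner_le_norm _ _)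
    have h5 : c ^ 2 ≤ a ^ 2 := by gcongr
    apply le_of_sq_le_sq _ (norm_nonneg z)
    rw [mul_pow, h1]
    nlinarith [sq_nonneg (σ - ⟪w, e⟫), mul_le_mul_of_nonneg_right h5 (sq_nonneg ‖w‖)]
  · have h1 : ⟪z, n⟫ = - (σ * a) := by
      rw [hz, inner_sub_left, h, inner_smul_left, ← ha]; simp
    have h2 := abs_real_inner_le_norm z n
    rw [h1, hn, mul_one, abs_neg, abs_mul] at h2
    have : c * |σ| ≤ |σ| * |a| := by
      rw [mul_comm]; gcongr; exact hen.trans (le_abs_self _)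
    linarith

lemma tub_mvt {m : ℕ} (ρ : ℝ) (u : EuclideanSpace ℝ (Fin m) → ℝ)
    (hdiff : ∀ q ∈ ball (0 : EuclideanSpace ℝ (Fin m)) ρ, DifferentiableAt ℝ u q)
    (x y : EuclideanSpace ℝ (Fin m)) (hx : x ∈ ball (0 : EuclideanSpace ℝ (Fin m)) ρ)
    (hy : y ∈ ball (0 : EuclideanSpace ℝ (Fin m)) ρ) :
    ∃ q ∈ ball (0 : EuclideanSpace ℝ (Fin m)) ρ, u x - u y = ⟪gradient u q, x - y⟫ := by
  obtain ⟨q, hq, h⟩ := domain_mvt (f := u) (f' := fun q => fderiv ℝ u q)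
    (fun q hq => (hdiff q hq).hasFDerivAt.hasFDerivWithinAt) (convex_ball _ _) hy hx
  refine ⟨q, (convex_ball _ _).segment_subset hy hx hq, ?_⟩
  rw [h, gradient, InnerProductSpace.toDual_symm_apply]

noncomputable def tubN {m : ℕ} (v : EuclideanSpace ℝ (Fin m)) :
    WithLp 2 (EuclideanSpace ℝ (Fin m) × ℝ) :=
  (Real.sqrt (1 + ‖v‖ ^ 2))⁻¹ • (WithLp.equiv 2 (EuclideanSpace ℝ (Fin m) × ℝ)).symm (-v, 1)

def tubG {m : ℕ} (u : EuclideanSpace ℝ (Fin m) → ℝ) (x : EuclideanSpace ℝ (Fin m)) :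
    WithLp 2 (EuclideanSpace ℝ (Fin m) × ℝ) :=
  (WithLp.equiv 2 (EuclideanSpace ℝ (Fin m) × ℝ)).symm (x, u x)

lemma tubN_inner {m : ℕ} (v : EuclideanSpace ℝ (Fin m))
    (w : WithLp 2 (EuclideanSpace ℝ (Fin m) × ℝ)) :
    ⟪w, tubN v⟫ = (Real.sqrt (1 + ‖v‖ ^ 2))⁻¹ * (w.snd - ⟪v, w.fst⟫) := by
  rw [tubN, inner_smul_right, WithLp.prod_inner_apply]
  congr 1
  simp [real_inner_comm]
  ring

lemma tubN_norm {m : ℕ} (v : EuclideanSpace ℝ (Fin m)) : ‖tubN v‖ = 1 := by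
  have h : 0 < 1 + ‖v‖ ^ 2 := by positivity
  rw [tubN, norm_smul]
  have : ‖(WithLp.equiv 2 (EuclideanSpace ℝ (Fin m) × ℝ)).symm (-v, 1)‖
      = Real.sqrt (1 + ‖v‖ ^ 2) := by
    rw [← Real.sqrt_sq (norm_nonneg _), WithLp.prod_norm_sq_eq_of_L2]
    simp [add_comm]
  rw [this, norm_inv, Real.norm_of_nonneg (Real.sqrt_nonneg _)]
  exact inv_mul_cancel₀ (Real.sqrt_pos.2 h).ne'

lemma tub_key {m : ℕ} (ρ c : ℝ) (hc : 0 < c) (u : EuclideanSpace ℝ (Fin m) → ℝ)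
    (hdiff : ∀ q ∈ ball (0 : EuclideanSpace ℝ (Fin m)) ρ, DifferentiableAt ℝ u q)
    (e : WithLp 2 (EuclideanSpace ℝ (Fin m) × ℝ)) (he : ‖e‖ = 1)
    (hen : ∀ q ∈ ball (0 : EuclideanSpace ℝ (Fin m)) ρ, c ≤ ⟪e, tubN (gradient u q)⟫)
    (x y : EuclideanSpace ℝ (Fin m)) (hx : x ∈ ball (0 : EuclideanSpace ℝ (Fin m)) ρ)
    (hy : y ∈ ball (0 : EuclideanSpace ℝ (Fin m)) ρ) (σ : ℝ) :
    c * ‖x - y‖ ≤ ‖tubG u x - tubG u y + σ • e‖ ∧ c * |σ| ≤ ‖tubG u x - tubG u y + σ • e‖ := by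
  obtain ⟨q, hq, h⟩ := tub_mvt ρ u hdiff x y hx hy
  have := tub_proj (tubN (gradient u q)) e (tubG u x - tubG u y + σ • e) (-σ) c hc
    (tubN_norm _) he (hen q hq) (by
      rw [tubN_inner]
      simp [tubG, h])
  have h2 : tubG u x - tubG u y + σ • e + (-σ) • e = tubG u x - tubG u y := by
    rw [neg_smul]; abel
  rw [h2, abs_neg] at this
  refine ⟨le_trans ?_ this.1, this.2⟩
  gcongr
  exact WithLp.norm_fst_le _ (tubG u x - tubG u y)

lemma tub_open0 {m : ℕ} (ρ c : ℝ) (hc : 0 < c) (u : EuclideanSpace ℝ (Fin m) → ℝ)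
    (hdiff : ∀ q ∈ ball (0 : EuclideanSpace ℝ (Fin m)) ρ, DifferentiableAt ℝ u q)
    (e : WithLp 2 (EuclideanSpace ℝ (Fin m) × ℝ)) (he : ‖e‖ = 1)
    (hen : ∀ q ∈ ball (0 : EuclideanSpace ℝ (Fin m)) ρ, c ≤ ⟪e, tubN (gradient u q)⟫)
    (V : Set (EuclideanSpace ℝ (Fin m) × ℝ)) (hV : IsOpen V)
    (hVB : ∀ z ∈ V, z.1 ∈ ball (0 : EuclideanSpace ℝ (Fin m)) ρ) :
    IsOpen ((fun z : EuclideanSpace ℝ (Fin m) × ℝ => tubG u z.1 + z.2 • e) '' V) := by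
  rw [isOpen_iff_mem_nhds]
  rintro _ ⟨⟨x, t⟩, hxt, rfl⟩
  set w₀ := tubG u x + t • e with hw₀
  obtain ⟨r, hr, hrV⟩ := Metric.isOpen_iff.1 hV _ hxt
  have hfe : ‖e.fst‖ ≤ 1 := he ▸ WithLp.norm_fst_le _ e
  have hw00 : ‖w₀ - w₀‖ < r / 2 := by rw [sub_self, norm_zero]; exact half_pos hr
  have mem : ∀ w s, ‖w - w₀‖ < r / 2 → |s - t| ≤ r / 2 → ((w - s • e).fst, s) ∈ V := by
    intro w s hw hs
    apply hrV
    rw [← ball_prod_same]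
    refine ⟨?_, ?_⟩
    · rw [mem_ball, dist_eq_norm]
      have : (w - s • e).fst - x = (w - w₀).fst - (s - t) • e.fst := by
        simp [hw₀, tubG, sub_smul]
        abel
      simp only [this]
      calc _ ≤ ‖(w - w₀).fst‖ + ‖(s - t) • e.fst‖ := norm_sub_le _ _
        _ ≤ ‖w - w₀‖ + |s - t| * 1 := by
          rw [norm_smul]
          gcongr
          · exact WithLp.norm_fst_le _ _
          · exact le_rfl
        _ < r := by linarith
    · rw [mem_ball, Real.dist_eq]
      simp only
      linarith
  have hxB : x ∈ ball (0 : EuclideanSpace ℝ (Fin m)) ρ := hVB (x, t) hxt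
  have hVm : ∀ w s, ‖w - w₀‖ < r / 2 → |s - t| ≤ r / 2 →
      (w - s • e).fst ∈ ball (0 : EuclideanSpace ℝ (Fin m)) ρ := by
    intro w s hw hs
    have := hVB ((w - s • e).fst, s) (mem w s hw hs)
    exact this
  let φ : WithLp 2 (EuclideanSpace ℝ (Fin m) × ℝ) → ℝ → ℝ :=
    fun w s => (w - s • e).snd - u ((w - s • e).fst)
  have hφ0 : ∀ s, |s - t| ≤ r / 2 → ∃ k : ℝ, 0 < k ∧ φ w₀ s = - (s - t) * k := by
    intro s hs
    have h1 := hVm w₀ s hw00 hs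
    obtain ⟨q, hq, h⟩ := tub_mvt ρ u hdiff x (w₀ - s • e).fst hxB h1
    have h2 := hen q hq
    have hk : 0 < Real.sqrt (1 + ‖gradient u q‖ ^ 2) := Real.sqrt_pos.2 (by positivity)
    rw [tubN_inner] at h2
    refine ⟨e.snd - ⟪gradient u q, e.fst⟫, ?_, ?_⟩
    · have := lt_of_lt_of_le hc h2
      exact (pos_iff_pos_of_mul_pos this).1 (inv_pos.2 hk)
    · have h3 : x - (w₀ - s • e).fst = (s - t) • e.fst := by
        simp [hw₀, tubG, sub_smul]
        abel
      rw [h3, inner_smul_right] at h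
      have h4 : (w₀ - s • e).snd = u x - (s - t) * e.snd := by
        simp [hw₀, tubG]; ring
      simp only [φ]
      rw [h4]
      linarith
  have hφc : ∀ w s, ‖w - w₀‖ < r / 2 → |s - t| ≤ r / 2 →
      ContinuousAt (fun p : WithLp 2 (EuclideanSpace ℝ (Fin m) × ℝ) × ℝ => φ p.1 p.2) (w, s) := by
    intro w s hw hs
    have h1 := (hdiff _ (hVm w s hw hs)).continuousAt
    have h2 : Continuous (fun p : WithLp 2 (EuclideanSpace ℝ (Fin m) × ℝ) × ℝ =>
      (p.1 - p.2 • e)) := by fun_prop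
    have h3 : Continuous (fun p : WithLp 2 (EuclideanSpace ℝ (Fin m) × ℝ) × ℝ =>
      (p.1 - p.2 • e).fst) := (WithLp.fstL 2 ℝ _ _).continuous.comp h2
    have h4 : Continuous (fun p : WithLp 2 (EuclideanSpace ℝ (Fin m) × ℝ) × ℝ =>
      (p.1 - p.2 • e).snd) := (WithLp.sndL 2 ℝ _ _).continuous.comp h2
    exact h4.continuousAt.sub (ContinuousAt.comp (x := (w, s)) (g := u) h1 h3.continuousAt)
  have hab : ∀ s, |s - t| ≤ r / 2 → ContinuousAt (fun w => φ w s) w₀ := by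
    intro s hs
    exact ContinuousAt.comp (x := w₀) (f := fun w => (w, s)) (hφc w₀ s hw00 hs)
      (by fun_prop)
  have ha : |t - r / 2 - t| ≤ r / 2 := by
    rw [show t - r / 2 - t = - (r / 2) by ring, abs_neg, abs_of_pos (by positivity)]
  have hb : |t + r / 2 - t| ≤ r / 2 := by
    rw [show t + r / 2 - t = r / 2 by ring, abs_of_pos (by positivity)]
  have hpa : 0 < φ w₀ (t - r / 2) := by
    obtain ⟨k, hk, h⟩ := hφ0 _ ha
    rw [h, show - (t - r / 2 - t) * k = r / 2 * k by ring]; positivity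
  have hpb : φ w₀ (t + r / 2) < 0 := by
    obtain ⟨k, hk, h⟩ := hφ0 _ hb
    rw [h, show - (t + r / 2 - t) * k = - (r / 2 * k) by ring]
    have : 0 < r / 2 * k := by positivity
    linarith
  filter_upwards [(hab _ ha).eventually (lt_mem_nhds hpa), (hab _ hb).eventually (gt_mem_nhds hpb),
    Metric.ball_mem_nhds w₀ (half_pos hr)] with w h1 h2 h3
  rw [mem_ball, dist_eq_norm] at h3
  have hcont : ContinuousOn (φ w) (Set.Icc (t - r / 2) (t + r / 2)) := by
    intro s hs
    have hs' : |s - t| ≤ r / 2 := abs_le.2 ⟨by linarith [hs.1], by linarith [hs.2]⟩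
    exact (ContinuousAt.comp (x := s) (f := fun s => (w, s)) (hφc w s h3 hs')
      (by fun_prop)).continuousWithinAt
  obtain ⟨s, hs, hs0⟩ := intermediate_value_Icc' (by linarith) hcont ⟨h2.le, h1.le⟩
  have hs' : |s - t| ≤ r / 2 := abs_le.2 ⟨by linarith [hs.1], by linarith [hs.2]⟩
  refine ⟨_, mem w s h3 hs', ?_⟩
  have h5 : tubG u (w - s • e).fst = w - s • e := by
    have h6 : u (w - s • e).fst = (w - s • e).snd := by
      simp only [φ] at hs0; linarith
    rw [tubG, h6]
    rfl
  simp only [h5]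
  abel

lemma tub_open {m : ℕ} (ρ c L : ℝ) (hc : 0 < c) (hL : 0 < L) (u : EuclideanSpace ℝ (Fin m) → ℝ)
    (hdiff : ∀ q ∈ ball (0 : EuclideanSpace ℝ (Fin m)) ρ, DifferentiableAt ℝ u q)
    (T : EuclideanSpace ℝ (Fin m) → WithLp 2 (EuclideanSpace ℝ (Fin m) × ℝ))
    (hTlip : ∀ p ∈ ball (0 : EuclideanSpace ℝ (Fin m)) ρ,
      ∀ q ∈ ball (0 : EuclideanSpace ℝ (Fin m)) ρ, ‖T p - T q‖ ≤ L * ‖p - q‖)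
    (hT1 : ∀ p ∈ ball (0 : EuclideanSpace ℝ (Fin m)) ρ, ‖T p‖ = 1)
    (hTν : ∀ p ∈ ball (0 : EuclideanSpace ℝ (Fin m)) ρ,
      ∀ q ∈ ball (0 : EuclideanSpace ℝ (Fin m)) ρ, c ≤ ⟪T p, tubN (gradient u q)⟫)
    (V : Set (EuclideanSpace ℝ (Fin m) × ℝ)) (hV : IsOpen V)
    (hVB : ∀ z ∈ V, z.1 ∈ ball (0 : EuclideanSpace ℝ (Fin m)) ρ ∧ |z.2| < c / L) :
    IsOpen ((fun z : EuclideanSpace ℝ (Fin m) × ℝ => tubG u z.1 + z.2 • T z.1) '' V) := by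
  rw [isOpen_iff_mem_nhds]
  rintro _ ⟨⟨x, t⟩, hxt, rfl⟩
  obtain ⟨r₀, hr₀, hrV₀⟩ := Metric.isOpen_iff.1 hV _ hxt
  obtain ⟨hxB, htB⟩ := hVB _ hxt
  simp only at hxB htB
  obtain ⟨r, hr, hrr, hrt⟩ : ∃ r > 0, r ≤ r₀ ∧ |t| + 2 * r < c / L :=
    ⟨min r₀ ((c / L - |t|) / 3), lt_min hr₀ (by linarith), min_le_left _ _, by
      have := min_le_right r₀ ((c / L - |t|) / 3); linarith⟩
  set U : Set (EuclideanSpace ℝ (Fin m) × ℝ) := ball (x, t) r with hU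
  have hUV : U ⊆ V := (ball_subset_ball hrr).trans hrV₀
  set F : EuclideanSpace ℝ (Fin m) × ℝ → WithLp 2 (EuclideanSpace ℝ (Fin m) × ℝ) :=
    fun z => tubG u z.1 + z.2 • T z.1 with hF
  set F₀ : EuclideanSpace ℝ (Fin m) × ℝ → WithLp 2 (EuclideanSpace ℝ (Fin m) × ℝ) :=
    fun z => tubG u z.1 + z.2 • T x with hF₀
  have hW : IsOpen (F₀ '' U) := tub_open0 ρ c hc u hdiff (T x) (hT1 x hxB) (hTν x hxB) U
    isOpen_ball (fun z hz => (hVB z (hUV hz)).1)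
  have est : ∀ z ∈ U, ∀ z' ∈ U, ‖F z - F z' - (F₀ z - F₀ z')‖ ≤
      (|t| + 2 * r) * L / c * ‖F₀ z - F₀ z'‖ := by
    rintro ⟨y, s⟩ hz ⟨y', s'⟩ hz'
    have hy := (hVB _ (hUV hz)).1
    have hy' := (hVB _ (hUV hz')).1
    simp only at hy hy'
    have hzz := hz
    rw [hU, ← ball_prod_same] at hzz hz'
    obtain ⟨-, h2⟩ := hzz
    obtain ⟨h1', -⟩ := hz'
    simp only [mem_ball, dist_eq_norm] at h2 h1'
    rw [Real.norm_eq_abs] at h2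
    have hs : |s| ≤ |t| + r := by
      have := abs_sub_abs_le_abs_sub s t; linarith
    obtain ⟨k1, k2⟩ := tub_key ρ c hc u hdiff (T x) (hT1 x hxB) (hTν x hxB) y y' hy hy' (s - s')
    have e1 : tubG u y - tubG u y' + (s - s') • T x = F₀ (y, s) - F₀ (y', s') := by
      simp only [hF₀, sub_smul]; abel
    rw [e1] at k1 k2
    set D := ‖F₀ (y, s) - F₀ (y', s')‖
    have e2 : F (y, s) - F (y', s') - (F₀ (y, s) - F₀ (y', s')) =
        s • (T y - T y') + (s - s') • (T y' - T x) := by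
      simp only [hF, hF₀, sub_smul, smul_sub]; abel
    have k3 : ‖T y' - T x‖ ≤ L * r := (hTlip _ hy' _ hxB).trans (by gcongr)
    have k4 := hTlip _ hy _ hy'
    rw [e2]
    calc _ ≤ |s| * ‖T y - T y'‖ + |s - s'| * ‖T y' - T x‖ := by
          refine (norm_add_le _ _).trans_eq ?_
          rw [norm_smul, norm_smul]; rfl
      _ ≤ (|t| + r) * (L * (D / c)) + (D / c) * (L * r) := by
          have : ‖y - y'‖ ≤ D / c := by rw [le_div_iff₀ hc]; linarith
          have : |s - s'| ≤ D / c := by rw [le_div_iff₀ hc]; linarith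
          have : ‖T y - T y'‖ ≤ L * (D / c) := k4.trans (by gcongr)
          gcongr
      _ = _ := by ring
  set κ : NNReal := ⟨(|t| + 2 * r) * L / c, by positivity⟩ with hκ
  have hκ1 : κ < 1 := by
    rw [← NNReal.coe_lt_coe]
    change (|t| + 2 * r) * L / c < 1
    rw [div_lt_one hc]
    rwa [lt_div_iff₀ hL] at hrt
  have hinv : ∀ w ∈ F₀ '' U, Function.invFunOn F₀ U w ∈ U ∧ F₀ (Function.invFunOn F₀ U w) = w :=
    fun w hw => ⟨Function.invFunOn_mem hw, Function.invFunOn_eq hw⟩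
  have happ : ApproximatesLinearOn (fun w => F (Function.invFunOn F₀ U w))
      (ContinuousLinearMap.id ℝ (WithLp 2 (EuclideanSpace ℝ (Fin m) × ℝ))) (F₀ '' U) κ := by
    intro w hw w' hw'
    have := est _ (hinv w hw).1 _ (hinv w' hw').1
    rw [(hinv w hw).2, (hinv w' hw').2] at this
    exact this
  have hop := happ.open_image
    { toFun := id, nnnorm := 1, bound' := by simp, right_inv' := by intro y; rfl }
    hW (Or.inr (by simpa using hκ1))
  have hinj : Set.InjOn F₀ U := by
    rintro ⟨y, s⟩ hz ⟨y', s'⟩ hz' h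
    obtain ⟨k1, k2⟩ := tub_key ρ c hc u hdiff (T x) (hT1 x hxB) (hTν x hxB) y y'
      (hVB _ (hUV hz)).1 (hVB _ (hUV hz')).1 (s - s')
    have e1 : tubG u y - tubG u y' + (s - s') • T x = F₀ (y, s) - F₀ (y', s') := by
      simp only [hF₀, sub_smul]; abel
    rw [e1, h, sub_self, norm_zero] at k1 k2
    have a1 : ‖y - y'‖ = 0 := le_antisymm (by by_contra! hh; nlinarith) (norm_nonneg _)
    have a2 : |s - s'| = 0 := le_antisymm (by by_contra! hh; nlinarith) (abs_nonneg _)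
    rw [norm_eq_zero, sub_eq_zero] at a1
    rw [abs_eq_zero, sub_eq_zero] at a2
    rw [a1, a2]
  have hxU : (x, t) ∈ U := mem_ball_self hr
  refine Filter.mem_of_superset (hop.mem_nhds ⟨F₀ (x, t), ⟨_, hxU, rfl⟩, ?_⟩) ?_
  · have : Function.invFunOn F₀ U (F₀ (x, t)) = (x, t) := hinj.leftInvOn_invFunOn hxU
    simp only [this, hF]
  · rintro _ ⟨w, hw, rfl⟩
    exact ⟨_, hUV (hinv w hw).1, rfl⟩

/-- Under the hypotheses of the tubular-neighborhood lemma (a `L`-Lipschitz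
unit field `T` making angle at most `γ < π/2` with all graph normals `ν(q)`), the tubular map
`F(x, t) = (x, u x) + t • T x` is injective on `B_ρ × (-ε, ε)` with `ε = (cos γ)/L`, and (by
invariance of domain) it maps this set homeomorphically onto an open neighborhood of the graph
`{(x, u x) : x ∈ B_ρ}` in `ℝ^{m+1}`. -/
theorem stmt_9 {m : ℕ} (hm : 1 ≤ m) (ρ L γ ε : ℝ) (hρ : 0 < ρ) (hL : 0 < L) (hγ0 : 0 ≤ γ)
    (hγ : γ < Real.pi / 2) (hε : ε = Real.cos γ / L)
    (u : EuclideanSpace ℝ (Fin m) → ℝ)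
    (hdiff : ∀ q ∈ ball (0 : EuclideanSpace ℝ (Fin m)) ρ, DifferentiableAt ℝ u q)
    (ν : EuclideanSpace ℝ (Fin m) → WithLp 2 (EuclideanSpace ℝ (Fin m) × ℝ))
    (hν : ∀ q ∈ ball (0 : EuclideanSpace ℝ (Fin m)) ρ,
      ν q = (Real.sqrt (1 + ‖gradient u q‖ ^ 2))⁻¹ •
        (WithLp.equiv 2 (EuclideanSpace ℝ (Fin m) × ℝ)).symm (-(gradient u q), 1))
    (T : EuclideanSpace ℝ (Fin m) → WithLp 2 (EuclideanSpace ℝ (Fin m) × ℝ))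
    (hTlip : ∀ p ∈ ball (0 : EuclideanSpace ℝ (Fin m)) ρ,
      ∀ q ∈ ball (0 : EuclideanSpace ℝ (Fin m)) ρ, ‖T p - T q‖ ≤ L * ‖p - q‖)
    (hT1 : ∀ p ∈ ball (0 : EuclideanSpace ℝ (Fin m)) ρ, ‖T p‖ = 1)
    (hTν : ∀ p ∈ ball (0 : EuclideanSpace ℝ (Fin m)) ρ,
      ∀ q ∈ ball (0 : EuclideanSpace ℝ (Fin m)) ρ, Real.cos γ ≤ ⟪T p, ν q⟫)
    (F : EuclideanSpace ℝ (Fin m) × ℝ → WithLp 2 (EuclideanSpace ℝ (Fin m) × ℝ))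
    (hF : ∀ x t, F (x, t) =
      (WithLp.equiv 2 (EuclideanSpace ℝ (Fin m) × ℝ)).symm (x, u x) + t • T x)
    (S : Set (EuclideanSpace ℝ (Fin m) × ℝ))
    (hS : S = (ball (0 : EuclideanSpace ℝ (Fin m)) ρ) ×ˢ (Set.Ioo (-ε) ε)) :
    Set.InjOn F S ∧ IsOpen (F '' S) ∧
      (fun x => (WithLp.equiv 2 (EuclideanSpace ℝ (Fin m) × ℝ)).symm (x, u x)) ''
        ball (0 : EuclideanSpace ℝ (Fin m)) ρ ⊆ F '' S ∧
      ∃ e : S ≃ₜ (F '' S), ∀ z : S, (e z : WithLp 2 (EuclideanSpace ℝ (Fin m) × ℝ)) = F z := by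
  have hc : 0 < Real.cos γ := Real.cos_pos_of_mem_Ioo ⟨by linarith [Real.pi_pos], hγ⟩
  have hε0 : 0 < ε := hε ▸ div_pos hc hL
  have hTν' : ∀ p ∈ ball (0 : EuclideanSpace ℝ (Fin m)) ρ,
      ∀ q ∈ ball (0 : EuclideanSpace ℝ (Fin m)) ρ,
      Real.cos γ ≤ ⟪T p, tubN (gradient u q)⟫ := by
    intro p hp q hq
    have := hTν p hp q hq
    rwa [hν q hq] at this
  have hFe : F = fun z => tubG u z.1 + z.2 • T z.1 := by
    funext ⟨x, t⟩; exact hF x t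
  have hmem : ∀ z ∈ S, z.1 ∈ ball (0 : EuclideanSpace ℝ (Fin m)) ρ ∧
      |z.2| < Real.cos γ / L := by
    intro z hz
    rw [hS] at hz
    exact ⟨hz.1, hε ▸ abs_lt.2 hz.2⟩
  have hSo : IsOpen S := hS ▸ isOpen_ball.prod isOpen_Ioo
  have hopen : ∀ V ⊆ S, IsOpen V → IsOpen (F '' V) := by
    intro V hVS hV
    rw [hFe]
    exact tub_open ρ _ L hc hL u hdiff T hTlip hT1 hTν' V hV (fun z hz => hmem z (hVS hz))
  have hinj : Set.InjOn F S := by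
    rintro ⟨x, t⟩ hz ⟨y, s⟩ hz' h
    obtain ⟨hx, -⟩ := hmem _ hz
    obtain ⟨hy, hs⟩ := hmem _ hz'
    simp only at hx hy hs
    obtain ⟨k1, k2⟩ := tub_key ρ _ hc u hdiff (T x) (hT1 x hx) (hTν' x hx) x y hx hy (t - s)
    have e1 : tubG u x - tubG u y + (t - s) • T x = s • (T y - T x) := by
      rw [hFe] at h
      simp only at h
      rw [sub_smul, smul_sub, ← sub_eq_zero]
      rw [← sub_eq_zero] at h
      rw [← h]; abel
    have k3 := hTlip _ hy _ hx
    rw [e1, norm_smul, Real.norm_eq_abs] at k1 k2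
    rw [lt_div_iff₀ hL] at hs
    rw [norm_sub_rev y x] at k3
    have k4 : |s| * ‖T y - T x‖ ≤ |s| * (L * ‖x - y‖) := by gcongr
    have a1 : ‖x - y‖ = 0 := le_antisymm (by by_contra! hh; nlinarith) (norm_nonneg _)
    rw [a1] at k4
    have a2 : |t - s| = 0 := le_antisymm (by by_contra! hh; nlinarith) (abs_nonneg _)
    rw [norm_eq_zero, sub_eq_zero] at a1
    rw [abs_eq_zero, sub_eq_zero] at a2
    rw [a1, a2]
  have hcont : ContinuousOn F S := by
    have huc : ContinuousOn u (ball (0 : EuclideanSpace ℝ (Fin m)) ρ) :=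
      fun q hq => (hdiff q hq).continuousAt.continuousWithinAt
    have hTc : ContinuousOn T (ball (0 : EuclideanSpace ℝ (Fin m)) ρ) :=
      (LipschitzOnWith.of_dist_le_mul (K := ⟨L, hL.le⟩) (fun p hp q hq => by
        rw [dist_eq_norm, dist_eq_norm]; exact hTlip p hp q hq)).continuousOn
    have hm1 : Set.MapsTo Prod.fst S (ball (0 : EuclideanSpace ℝ (Fin m)) ρ) :=
      fun z hz => (hmem z hz).1
    rw [hFe]
    refine ContinuousOn.add ?_ (continuousOn_snd.smul (hTc.comp continuousOn_fst hm1))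
    exact (WithLp.prod_continuous_toLp 2 _ _).comp_continuousOn
      (continuousOn_fst.prodMk (huc.comp continuousOn_fst hm1))
  refine ⟨hinj, hopen S subset_rfl hSo, ?_, ?_⟩
  · rintro _ ⟨x, hx, rfl⟩
    refine ⟨(x, 0), ?_, ?_⟩
    · rw [hS]; exact ⟨hx, by simpa using hε0⟩
    · rw [hF]; simp
  · let e0 : S ≃ (F '' S) := Equiv.Set.imageOfInjOn F S hinj
    have he0 : ∀ z : S, (e0 z : WithLp 2 (EuclideanSpace ℝ (Fin m) × ℝ)) = F z := fun z => rfl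
    refine ⟨e0.toHomeomorphOfContinuousOpen ?_ ?_, fun z => rfl⟩
    · exact Continuous.subtype_mk hcont.domRestrict _
    · intro A hA
      have h1 := hopen (Subtype.val '' A) (by rintro _ ⟨a, -, rfl⟩; exact a.2)
        (hSo.isOpenMap_subtype_val A hA)
      refine ⟨_, h1, ?_⟩
      ext ⟨w, hw⟩
      constructor
      · rintro ⟨_, ⟨a, ha, rfl⟩, h⟩
        exact ⟨a, ha, Subtype.ext h⟩
      · rintro ⟨a, ha, h⟩
        exact ⟨a, ⟨a, ha, rfl⟩, congrArg Subtype.val h⟩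
end

section
/- Let m ≥ 1, ρ > 0, λ ≥ 0, 0 < L < ∞ and 0 ≤ γ < π/2. Let u be a real-valued differentiable function on the closed ball of radius ρ in ℝ^m with |∇u| ≤ λ everywhere, and let ν(q) = (1 + |∇u(q)|²)^{-1/2} · (−∇u(q), 1) be the upward unit normal to its graph at q. Let T be an L-Lipschitz map from the closed ball of radius ρ to ℝ^{m+1} with |T(p)| = 1 and ⟨T(p), ν(q)⟩ ≥ cos γ for all p, q in the closed ball. Set ε = (cos γ)/L and σ = min{(ρ/2)·cos γ, (cos² γ)/(2L(1+λ))}. Then every point z ∈ ℝ^{m+1} whose Euclidean distance to the set {(x, u(x)) : |x| ≤ ρ/2} is less than σ belongs to {(x, u(x)) + t·T(x) : |x| < ρ, |t| < ε}. -/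
open Metric
open scoped RealInnerProductSpace

lemma aux_oblique {E : Type*} [NormedAddCommGroup E] [InnerProductSpace ℝ E] (w T n : E)
    (hT : ‖T‖ = 1) (hn : ‖n‖ = 1) : ‖⟪T, n⟫ • w - ⟪w, n⟫ • T‖ ≤ ‖w‖ := by
  have hC := real_inner_mul_inner_self_le (n - ⟪T, n⟫ • T) (w - ⟪w, T⟫ • T)
  have hTT : ⟪T, T⟫ = 1 := by rw [real_inner_self_eq_norm_sq, hT]; norm_num
  have hnn : ⟪n, n⟫ = 1 := by rw [real_inner_self_eq_norm_sq, hn]; norm_num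
  have h1 : ⟪n, T⟫ = ⟪T, n⟫ := real_inner_comm _ _
  have h2 : ⟪n, w⟫ = ⟪w, n⟫ := real_inner_comm _ _
  have h3 : ⟪T, w⟫ = ⟪w, T⟫ := real_inner_comm _ _
  simp only [inner_sub_left, inner_sub_right, real_inner_smul_left, real_inner_smul_right,
    hTT, hnn, h1, h2, h3] at hC
  apply le_of_sq_le_sq _ (norm_nonneg _)
  rw [← real_inner_self_eq_norm_sq, ← real_inner_self_eq_norm_sq]
  simp only [inner_sub_left, inner_sub_right, real_inner_smul_left, real_inner_smul_right,
    hTT, h3]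
  nlinarith [sq_nonneg ⟪w, T⟫]

lemma aux_eq {E : Type*} [NormedAddCommGroup E] [InnerProductSpace ℝ E] (w T n : E) (c t : ℝ)
    (hT : ‖T‖ = 1) (hn : ‖n‖ = 1) (hc : 0 < c) (hcT : c ≤ ⟪T, n⟫) (ht : ⟪w - t • T, n⟫ = 0) :
    c * ‖w - t • T‖ ≤ ‖w‖ := by
  have h := aux_oblique w T n hT hn
  have hβ : ⟪w, n⟫ = ⟪T, n⟫ * t := by
    rw [inner_sub_left, real_inner_smul_left] at ht; linarith
  rw [hβ, mul_smul, ← smul_sub, norm_smul, Real.norm_of_nonneg (by linarith)] at h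
  exact (mul_le_mul_of_nonneg_right hcT (norm_nonneg _)).trans h

lemma aux_le {E : Type*} [NormedAddCommGroup E] [InnerProductSpace ℝ E] (w T n : E) (c t : ℝ)
    (hT : ‖T‖ = 1) (hn : ‖n‖ = 1) (hc : 0 < c) (hcT : c ≤ ⟪T, n⟫) (ht0 : 0 ≤ t)
    (ht : 0 ≤ ⟪w - t • T, n⟫) :
    c * ‖w - t • T‖ ≤ ‖w‖ ∧ c * t ≤ ‖w‖ := by
  have h := aux_oblique w T n hT hn
  rw [inner_sub_left, real_inner_smul_left] at ht
  have hc1 : c ≤ 1 := by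
    have := real_inner_le_norm T n
    rw [hT, hn] at this; linarith
  have hwn : ⟪w, n⟫ ≤ ‖w‖ := by
    have := real_inner_le_norm w n
    rwa [hn, mul_one] at this
  have hct : c * t ≤ t * ⟪T, n⟫ := by nlinarith
  refine ⟨?_, by linarith⟩
  have hβ0 : 0 ≤ ⟪w, n⟫ := by nlinarith
  rcases hβ0.eq_or_lt with h0 | h0
  · have : t = 0 := by nlinarith
    rw [this, zero_smul, sub_zero]
    nlinarith [norm_nonneg w]
  · have e : ⟪w, n⟫ • (w - t • T) =
        (⟪w, n⟫ - t * ⟪T, n⟫) • w + t • (⟪T, n⟫ • w - ⟪w, n⟫ • T) := by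
      module
    have h4 : ⟪w, n⟫ * ‖w - t • T‖ ≤ (⟪w, n⟫ - t * ⟪T, n⟫) * ‖w‖ + t * ‖w‖ := by
      calc _ = ‖⟪w, n⟫ • (w - t • T)‖ := by rw [norm_smul, Real.norm_of_nonneg hβ0]
        _ ≤ _ := by
          rw [e]
          refine (norm_add_le _ _).trans ?_
          rw [norm_smul, norm_smul, Real.norm_of_nonneg ht0, Real.norm_of_nonneg (by linarith)]
          gcongr
    refine le_of_mul_le_mul_left ?_ h0
    have h5 := mul_le_mul_of_nonneg_left h4 hc.le
    have h6 : c * ((⟪w, n⟫ - t * ⟪T, n⟫) * ‖w‖) ≤ (⟪w, n⟫ - t * ⟪T, n⟫) * ‖w‖ := by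
      have : 0 ≤ (⟪w, n⟫ - t * ⟪T, n⟫) * ‖w‖ := mul_nonneg (by linarith) (norm_nonneg _)
      nlinarith
    have h7 := mul_le_mul_of_nonneg_right hct (norm_nonneg w)
    nlinarith

lemma aux_line_pos {E : Type*} [NormedAddCommGroup E] [InnerProductSpace ℝ E]
    (F : E → ℝ) (Y w T : E) (c R : ℝ) (hc : 0 < c) (hT : ‖T‖ = 1)
    (hw : ‖w‖ / c < R) (hwR : ‖w‖ ≤ R)
    (hF : ContinuousOn F (closedBall Y R)) (hY : F Y = 0)
    (H : ∀ z ∈ closedBall Y R, ∃ s > 0, ∃ n : E, ‖n‖ = 1 ∧ c ≤ ⟪T, n⟫ ∧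
      F z - F Y = s * ⟪z - Y, n⟫) (h0 : 0 ≤ F (Y + w)) :
    ∃ t : ℝ, F (Y + (w - t • T)) = 0 ∧ ‖w - t • T‖ ≤ ‖w‖ / c ∧ |t| ≤ ‖w‖ / c := by
  have key : ∀ t : ℝ, 0 ≤ t → ‖w - t • T‖ ≤ R → 0 ≤ F (Y + (w - t • T)) →
      ‖w - t • T‖ ≤ ‖w‖ / c ∧ t ≤ ‖w‖ / c := by
    intro t ht hR hFt
    obtain ⟨s, hs, n, hn, hcn, e⟩ := H (Y + (w - t • T)) (by simpa [mem_closedBall, dist_eq_norm] using hR)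
    rw [hY, sub_zero, add_sub_cancel_left] at e
    rw [e] at hFt
    have := aux_le w T n c t hT hn hc hcn ht (nonneg_of_mul_nonneg_right hFt hs)
    rw [le_div_iff₀ hc, le_div_iff₀ hc]
    constructor <;> linarith [this.1, this.2]
  let A : Set ℝ := Set.Icc 0 (‖w‖ / c + 1) ∩ {t | ‖w - t • T‖ ≤ R}
  have hA : IsCompact A := isCompact_Icc.inter_right
    (isClosed_le (by fun_prop) continuous_const)
  have hG : ContinuousOn (fun t : ℝ => F (Y + (w - t • T))) A := by
    refine hF.comp (by fun_prop) ?_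
    intro t ht
    simpa [mem_closedBall, dist_eq_norm] using ht.2
  have hS : IsCompact (A ∩ (fun t : ℝ => F (Y + (w - t • T))) ⁻¹' Set.Ici 0) :=
    hA.of_isClosed_subset (hG.preimage_isClosed_of_isClosed hA.isClosed isClosed_Ici)
      Set.inter_subset_left
  have hne : (A ∩ (fun t : ℝ => F (Y + (w - t • T))) ⁻¹' Set.Ici 0).Nonempty := by
    refine ⟨0, ⟨⟨le_rfl, by positivity⟩, by simpa using hwR⟩, by simpa using h0⟩
  obtain ⟨t, ⟨⟨⟨ht0, htK⟩, htR⟩, htF⟩, hmax⟩ := hS.exists_isGreatest hne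
  have hk := key t ht0 htR htF
  refine ⟨t, ?_, hk.1, by rw [abs_of_nonneg ht0]; exact hk.2⟩
  by_contra hne0
  have hpos : 0 < F (Y + (w - t • T)) := lt_of_le_of_ne htF (Ne.symm hne0)
  have hcont : ContinuousAt (fun t : ℝ => F (Y + (w - t • T))) t := by
    have h1 : ContinuousAt F (Y + (w - t • T)) := by
      refine hF.continuousAt (Filter.mem_of_superset (isOpen_ball.mem_nhds ?_) ball_subset_closedBall)
      simpa [mem_ball, dist_eq_norm] using hk.1.trans_lt hw
    exact ContinuousAt.comp (f := fun t : ℝ => Y + (w - t • T)) h1 (by fun_prop)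
  have e1 := hcont.eventually (lt_mem_nhds hpos)
  have e2 : ∀ᶠ t' in nhds t, ‖w - t' • T‖ < R := by
    have : ContinuousAt (fun t' : ℝ => ‖w - t' • T‖) t := by fun_prop
    exact this.eventually (gt_mem_nhds (hk.1.trans_lt hw))
  have e3 : ∀ᶠ t' in nhds t, t' < ‖w‖ / c + 1 := gt_mem_nhds (by linarith [hk.2])
  have e4 := ((e1.and (e2.and e3)).filter_mono (nhdsWithin_le_nhds (s := Set.Ioi t)))
  obtain ⟨t', ⟨a1, a2, a3⟩, a4⟩ := (e4.and self_mem_nhdsWithin).exists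
  have a4' : t < t' := a4
  have := hmax (show t' ∈ _ from ⟨⟨⟨by linarith, a3.le⟩, a2.le⟩, le_of_lt a1⟩)
  linarith

lemma aux_line {E : Type*} [NormedAddCommGroup E] [InnerProductSpace ℝ E]
    (F : E → ℝ) (Y w T : E) (c R : ℝ) (hc : 0 < c) (hT : ‖T‖ = 1)
    (hw : ‖w‖ / c < R) (hwR : ‖w‖ ≤ R)
    (hF : ContinuousOn F (closedBall Y R)) (hY : F Y = 0)
    (H : ∀ z ∈ closedBall Y R, ∃ s > 0, ∃ n : E, ‖n‖ = 1 ∧ c ≤ ⟪T, n⟫ ∧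
      F z - F Y = s * ⟪z - Y, n⟫) :
    ∃ t : ℝ, F (Y + (w - t • T)) = 0 ∧ ‖w - t • T‖ ≤ ‖w‖ / c ∧ |t| ≤ ‖w‖ / c := by
  rcases le_total 0 (F (Y + w)) with h | h
  · exact aux_line_pos F Y w T c R hc hT hw hwR hF hY H h
  · obtain ⟨t, h1, h2, h3⟩ := aux_line_pos (fun z => -F z) Y w (-T) c R hc (by simpa using hT) hw hwR
      hF.neg (by simpa using hY) (by
        intro z hz
        obtain ⟨s, hs, n, hn, hcn, e⟩ := H z hz
        refine ⟨s, hs, -n, by simpa using hn, by simpa using hcn, ?_⟩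
        simp only [inner_neg_right]; linarith) (by simpa using h)
    have e : w - t • (-T) = w - (-t) • T := by module
    rw [e] at h1 h2
    exact ⟨-t, by simpa using h1, h2, by simpa using h3⟩

/-- Size of the tubular neighborhood: with `u` differentiable on the closed
ball of radius `ρ`, `|∇u| ≤ λ`, `T` an `L`-Lipschitz unit field with `⟪T p, ν q⟫ ≥ cos γ`
against the graph normals, `ε = (cos γ)/L` and
`σ = min{(ρ/2) cos γ, cos²γ/(2L(1+λ))}`, every point of `ℝ^{m+1}` at distance `< σ` from the
graph over the closed ball of radius `ρ/2` lies in the tube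
`{(x, u x) + t • T x : |x| < ρ, |t| < ε}`. -/
theorem stmt_10 {m : ℕ} (hm : 1 ≤ m) (ρ lam L γ ε σ : ℝ) (hρ : 0 < ρ) (hlam : 0 ≤ lam)
    (hL : 0 < L) (hγ0 : 0 ≤ γ) (hγ : γ < Real.pi / 2)
    (hε : ε = Real.cos γ / L)
    (hσ : σ = min (ρ / 2 * Real.cos γ) (Real.cos γ ^ 2 / (2 * L * (1 + lam))))
    (u : EuclideanSpace ℝ (Fin m) → ℝ)
    (hdiff : ∀ q ∈ closedBall (0 : EuclideanSpace ℝ (Fin m)) ρ, DifferentiableAt ℝ u q)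
    (hgrad : ∀ q ∈ closedBall (0 : EuclideanSpace ℝ (Fin m)) ρ, ‖gradient u q‖ ≤ lam)
    (ν : EuclideanSpace ℝ (Fin m) → WithLp 2 (EuclideanSpace ℝ (Fin m) × ℝ))
    (hν : ∀ q ∈ closedBall (0 : EuclideanSpace ℝ (Fin m)) ρ,
      ν q = (Real.sqrt (1 + ‖gradient u q‖ ^ 2))⁻¹ •
        (WithLp.equiv 2 (EuclideanSpace ℝ (Fin m) × ℝ)).symm (-(gradient u q), 1))
    (T : EuclideanSpace ℝ (Fin m) → WithLp 2 (EuclideanSpace ℝ (Fin m) × ℝ))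
    (hTlip : ∀ p ∈ closedBall (0 : EuclideanSpace ℝ (Fin m)) ρ,
      ∀ q ∈ closedBall (0 : EuclideanSpace ℝ (Fin m)) ρ, ‖T p - T q‖ ≤ L * ‖p - q‖)
    (hT1 : ∀ p ∈ closedBall (0 : EuclideanSpace ℝ (Fin m)) ρ, ‖T p‖ = 1)
    (hTν : ∀ p ∈ closedBall (0 : EuclideanSpace ℝ (Fin m)) ρ,
      ∀ q ∈ closedBall (0 : EuclideanSpace ℝ (Fin m)) ρ, Real.cos γ ≤ ⟪T p, ν q⟫) :
    ∀ z : WithLp 2 (EuclideanSpace ℝ (Fin m) × ℝ),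
      Metric.infDist z
        ((fun x => (WithLp.equiv 2 (EuclideanSpace ℝ (Fin m) × ℝ)).symm (x, u x)) ''
          closedBall (0 : EuclideanSpace ℝ (Fin m)) (ρ / 2)) < σ →
      ∃ x : EuclideanSpace ℝ (Fin m), ∃ t : ℝ, ‖x‖ < ρ ∧ |t| < ε ∧
        z = (WithLp.equiv 2 (EuclideanSpace ℝ (Fin m) × ℝ)).symm (x, u x) + t • T x := by
  classical
  intro z hz
  set c := Real.cos γ with hc_def
  have hc : 0 < c := Real.cos_pos_of_mem_Ioo ⟨by linarith [Real.pi_pos], hγ⟩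
  have hc1 : c ≤ 1 := Real.cos_le_one _
  let gr : EuclideanSpace ℝ (Fin m) → WithLp 2 (EuclideanSpace ℝ (Fin m) × ℝ) := fun x => WithLp.toLp 2 (x, u x)
  let F : WithLp 2 (EuclideanSpace ℝ (Fin m) × ℝ) → ℝ := fun z => z.snd - u z.fst
  obtain ⟨Y, ⟨y, hy, rfl⟩, hzy⟩ := (infDist_lt_iff
    (Set.Nonempty.image _ ⟨0, mem_closedBall_self (by linarith)⟩)).1 hz
  change dist z (gr y) < σ at hzy
  rw [dist_eq_norm] at hzy
  set w := z - gr y with hw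
  rw [hσ, lt_min_iff] at hzy
  obtain ⟨hw1, hw2⟩ := hzy
  have hwc : ‖w‖ / c < ρ / 2 := by rw [div_lt_iff₀ hc]; exact hw1
  have hwc2 : ‖w‖ / c < c / (2 * L) := by
    rw [div_lt_iff₀ hc]
    refine hw2.trans_le ?_
    have : c / (2 * L) * c = c ^ 2 / (2 * L * 1) := by ring
    rw [this]
    gcongr
    linarith
  have hwR : ‖w‖ ≤ ρ / 2 := by nlinarith
  have hy' : ‖y‖ ≤ ρ / 2 := by simpa using hy
  have hfst : ∀ z' : WithLp 2 (EuclideanSpace ℝ (Fin m) × ℝ), ‖z'.fst‖ ≤ ‖z'‖ := fun z' => by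
    apply le_of_sq_le_sq _ (norm_nonneg _)
    rw [WithLp.prod_norm_sq_eq_of_L2]
    nlinarith [sq_nonneg ‖z'.snd‖]
  -- mean value
  have H : ∀ z₁ z₂ : WithLp 2 (EuclideanSpace ℝ (Fin m) × ℝ), z₁.fst ∈ closedBall (0 : EuclideanSpace ℝ (Fin m)) ρ →
      z₂.fst ∈ closedBall (0 : EuclideanSpace ℝ (Fin m)) ρ → ∃ s > 0, ∃ n : WithLp 2 (EuclideanSpace ℝ (Fin m) × ℝ), ‖n‖ = 1 ∧
      (∀ p ∈ closedBall (0 : EuclideanSpace ℝ (Fin m)) ρ, c ≤ ⟪T p, n⟫) ∧ F z₁ - F z₂ = s * ⟪z₁ - z₂, n⟫ := by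
    intro z₁ z₂ h₁ h₂
    obtain ⟨q, hq, e⟩ := domain_mvt (f := u) (f' := fun q => fderiv ℝ u q)
      (fun q hq => (hdiff q hq).hasFDerivAt.hasFDerivWithinAt) (convex_closedBall (0 : EuclideanSpace ℝ (Fin m)) ρ) h₂ h₁
    have hqB : q ∈ closedBall (0 : EuclideanSpace ℝ (Fin m)) ρ := (convex_closedBall (0 : EuclideanSpace ℝ (Fin m)) ρ).segment_subset h₂ h₁ hq
    have hs : 0 < Real.sqrt (1 + ‖gradient u q‖ ^ 2) := by positivity
    have e' : u z₁.fst - u z₂.fst = ⟪gradient u q, z₁.fst - z₂.fst⟫ := by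
      rw [e, gradient, InnerProductSpace.toDual_symm_apply]
    refine ⟨_, hs, ν q, ?_, fun p hp => hTν p hp q hqB, ?_⟩
    · rw [hν q hqB, norm_smul, norm_inv, Real.norm_of_nonneg hs.le, WithLp.prod_norm_eq_of_L2]
      simp only [WithLp.equiv_symm_apply, WithLp.toLp_fst, WithLp.toLp_snd, norm_neg, norm_one, one_pow]
      rw [add_comm (_ ^ 2) (1:ℝ)]
      exact inv_mul_cancel₀ hs.ne'
    · rw [hν q hqB, real_inner_smul_right, mul_inv_cancel_left₀ hs.ne', WithLp.prod_inner_apply]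
      simp only [F, WithLp.equiv_symm_apply]
      simp
      rw [map_sub] at e
      linarith
  have hFgr : ∀ x, F (gr x) = 0 := fun x => by simp [F, gr]
  have hball : ∀ z' ∈ closedBall (gr y) (ρ / 2), z'.fst ∈ closedBall (0 : EuclideanSpace ℝ (Fin m)) ρ := by
    intro z' hz'
    rw [mem_closedBall, dist_eq_norm] at hz'
    have h1 := (hfst (z' - gr y)).trans hz'
    have h2 : z'.fst = (z' - gr y).fst + y := by simp [gr]
    rw [mem_closedBall_zero_iff, h2]
    exact (norm_add_le _ _).trans (by linarith)
  have hFc : ContinuousOn F (closedBall (gr y) (ρ / 2)) := by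
    intro z' hz'
    have h1 := (hdiff _ (hball z' hz')).continuousAt
    have h2 : ContinuousAt (fun z : WithLp 2 (EuclideanSpace ℝ (Fin m) × ℝ) => u z.fst) z' :=
      ContinuousAt.comp (f := fun z : WithLp 2 (EuclideanSpace ℝ (Fin m) × ℝ) => z.fst) h1 (by fun_prop)
    have h3 : ContinuousAt (fun z : WithLp 2 (EuclideanSpace ℝ (Fin m) × ℝ) => z.snd) z' := by fun_prop
    exact (h3.sub h2).continuousWithinAt
  have hyB : (gr y).fst ∈ closedBall (0 : EuclideanSpace ℝ (Fin m)) ρ := hball _ (mem_closedBall_self (by linarith))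
  have ex : ∀ p : closedBall (0 : EuclideanSpace ℝ (Fin m)) ρ, ∃ t : ℝ, ∃ x : EuclideanSpace ℝ (Fin m), ‖x‖ < ρ ∧ z - t • T p = gr x ∧
      |t| ≤ ‖w‖ / c := by
    intro p
    obtain ⟨t, h1, h2, h3⟩ := aux_line F (gr y) w (T p) c (ρ / 2) hc (hT1 p p.2) hwc hwR hFc
      (hFgr y) (fun z' hz' => by
        obtain ⟨s, hs, n, hn, hcn, e⟩ := H z' (gr y) (hball z' hz') hyB
        exact ⟨s, hs, n, hn, hcn p p.2, e⟩)
    have e : gr y + (w - t • T p) = z - t • T p := by rw [hw]; abel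
    have e2 : (z - t • T p).fst = (w - t • T p).fst + y := by rw [← e, add_comm]; simp [gr]
    rw [e] at h1
    refine ⟨t, (z - t • T p).fst, ?_, ?_, h3⟩
    · rw [e2]
      exact (norm_add_le _ _).trans_lt (by linarith [hfst (w - t • T p)])
    · have h1' : (z - t • T p).snd = u (z - t • T p).fst := by simp only [F] at h1; linarith
      simp only [gr]
      rw [← h1']
      rfl
  choose t Φ hΦ hz' ht using ex
  let f : closedBall (0 : EuclideanSpace ℝ (Fin m)) ρ → closedBall (0 : EuclideanSpace ℝ (Fin m)) ρ :=
    fun p => ⟨Φ p, by simpa using (hΦ p).le⟩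
  have hf : ContractingWith (1 / 2) f := by
    refine ⟨by rw [← NNReal.coe_lt_coe]; norm_num, LipschitzWith.of_dist_le_mul fun p q => ?_⟩
    rw [Subtype.dist_eq, Subtype.dist_eq, dist_eq_norm, dist_eq_norm]
    change ‖Φ p - Φ q‖ ≤ _
    obtain ⟨s, hs, n, hn, hcn, e⟩ := H (gr (Φ p)) (gr (Φ q)) (f p).2 (f q).2
    rw [hFgr, hFgr, sub_zero] at e
    have e1 : gr (Φ p) - gr (Φ q) = t q • (T q - T p) - (t p - t q) • T p := by
      rw [← hz', ← hz']; module
    have e2 : ⟪gr (Φ p) - gr (Φ q), n⟫ = 0 := by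
      rcases mul_eq_zero.1 e.symm with h | h
      · exact absurd h hs.ne'
      · exact h
    have h1 := hfst (gr (Φ p) - gr (Φ q))
    have e3 : (gr (Φ p) - gr (Φ q)).fst = Φ p - Φ q := by simp [gr]
    rw [e3] at h1
    rw [e1] at h1 e2
    have h2 := aux_eq _ _ _ c _ (hT1 p p.2) hn hc (hcn p p.2) e2
    rw [norm_smul, Real.norm_eq_abs] at h2
    have h3 := hTlip q q.2 p p.2
    have h4 : |t q| * ‖T q - T p‖ ≤ (c / (2 * L)) * (L * ‖(q : EuclideanSpace ℝ (Fin m)) - p‖) :=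
      mul_le_mul ((ht q).trans hwc2.le) h3 (norm_nonneg _) (by positivity)
    have h5 : (c / (2 * L)) * (L * ‖(q : EuclideanSpace ℝ (Fin m)) - p‖) = c * (1 / 2 * ‖(p : EuclideanSpace ℝ (Fin m)) - q‖) := by
      rw [norm_sub_rev]; field_simp
    have h6 := le_of_mul_le_mul_left ((h2.trans h4).trans_eq h5) hc
    push_cast
    exact h1.trans h6
  haveI : Nonempty (closedBall (0 : EuclideanSpace ℝ (Fin m)) ρ) := ⟨⟨0, by simp [hρ.le]⟩⟩
  haveI : CompleteSpace (closedBall (0 : EuclideanSpace ℝ (Fin m)) ρ) := isClosed_closedBall.completeSpace_coe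
  let p := ContractingWith.fixedPoint f hf
  have hp : f p = p := hf.fixedPoint_isFixedPt
  have hp' : Φ p = p := congrArg Subtype.val hp
  refine ⟨p, t p, ?_, ?_, ?_⟩
  · rw [← hp']; exact hΦ p
  · rw [hε]
    refine ((ht p).trans_lt hwc2).trans_le ?_
    gcongr
    linarith
  · have := hz' p
    rw [hp'] at this
    exact sub_eq_iff_eq_add.1 this
end

section
/- Let m ≥ 1, ρ > 0, let u : B_ρ → ℝ be continuously differentiable, and for ξ ∈ B_ρ let T_ξ = span{(e₁, ∂₁u(ξ)), …, (e_m, ∂_m u(ξ))} ⊆ ℝ^{m+1} be the tangent space to the graph of u at ξ, where e₁, …, e_m is the standard basis of ℝ^m. Let w ∈ ℝ^{m+1}, w ≠ 0, be such that w ∉ T_ξ for every ξ ∈ B_ρ (equivalently ℝ^{m+1} = T_ξ ⊕ ℝw for every ξ). Then for every x ∈ ℝ^{m+1}, the line x + ℝw intersects the graph {(y, u(y)) : y ∈ B_ρ} in at most one point. -/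
open Metric

/-- If `w ≠ 0` lies outside the tangent space
`T_ξ = span{(e_i, ∂_i u(ξ))}` of the graph of the `C¹` function `u : B_ρ → ℝ` for every
`ξ ∈ B_ρ`, then every line `x + ℝ w` meets the graph `{(y, u y) : y ∈ B_ρ}` in at most one
point. -/
theorem stmt_11 {m : ℕ} (hm : 1 ≤ m) (ρ : ℝ) (hρ : 0 < ρ)
    (u : EuclideanSpace ℝ (Fin m) → ℝ)
    (hu : ContDiffOn ℝ 1 u (ball (0 : EuclideanSpace ℝ (Fin m)) ρ))
    (T : EuclideanSpace ℝ (Fin m) → Submodule ℝ (WithLp 2 (EuclideanSpace ℝ (Fin m) × ℝ)))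
    (hT : ∀ ξ ∈ ball (0 : EuclideanSpace ℝ (Fin m)) ρ,
      T ξ = Submodule.span ℝ (Set.range fun i : Fin m =>
        (WithLp.equiv 2 (EuclideanSpace ℝ (Fin m) × ℝ)).symm
          (EuclideanSpace.single i (1 : ℝ), fderiv ℝ u ξ (EuclideanSpace.single i (1 : ℝ)))))
    (w : WithLp 2 (EuclideanSpace ℝ (Fin m) × ℝ)) (hw : w ≠ 0)
    (hwT : ∀ ξ ∈ ball (0 : EuclideanSpace ℝ (Fin m)) ρ, w ∉ T ξ) :
    ∀ x : WithLp 2 (EuclideanSpace ℝ (Fin m) × ℝ),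
      Set.Subsingleton
        (((fun y => (WithLp.equiv 2 (EuclideanSpace ℝ (Fin m) × ℝ)).symm (y, u y)) ''
            ball (0 : EuclideanSpace ℝ (Fin m)) ρ) ∩
          {z | ∃ t : ℝ, z = x + t • w}) := by
  intro x
  rintro z₁ ⟨⟨y₁, hy₁, rfl⟩, t₁, h₁⟩ z₂ ⟨⟨y₂, hy₂, rfl⟩, t₂, h₂⟩
  by_cases ht : t₁ = t₂
  · subst ht
    exact h₁.trans h₂.symm
  exfalso
  have ht' : t₂ - t₁ ≠ 0 := fun h => ht (sub_eq_zero.mp h).symm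
  have a₁ : y₁ = x.fst + t₁ • w.fst := congrArg WithLp.fst h₁
  have a₂ : y₂ = x.fst + t₂ • w.fst := congrArg WithLp.fst h₂
  have b₁ : u y₁ = x.snd + t₁ * w.snd := congrArg WithLp.snd h₁
  have b₂ : u y₂ = x.snd + t₂ * w.snd := congrArg WithLp.snd h₂
  have hconv := convex_ball (0 : EuclideanSpace ℝ (Fin m)) ρ
  have hd : ∀ y ∈ ball (0 : EuclideanSpace ℝ (Fin m)) ρ,
      HasFDerivWithinAt u (fderiv ℝ u y) (ball (0 : EuclideanSpace ℝ (Fin m)) ρ) y := by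
    intro y hy
    have h := (hu.differentiableOn one_ne_zero).differentiableAt (isOpen_ball.mem_nhds hy)
    exact h.hasFDerivAt.hasFDerivWithinAt
  obtain ⟨ξ, hξ, hmv⟩ := domain_mvt hd hconv hy₁ hy₂
  have hξb := hconv.segment_subset hy₁ hy₂ hξ
  have e : y₂ - y₁ = (t₂ - t₁) • w.fst := by
    rw [a₁, a₂]; module
  rw [e, map_smul, smul_eq_mul] at hmv
  have hs : w.snd = fderiv ℝ u ξ w.fst := by
    apply mul_left_cancel₀ ht'
    rw [← hmv, b₁, b₂]; ring
  apply hwT ξ hξb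
  rw [hT ξ hξb]
  have hsum : w.fst = ∑ i, w.fst i • EuclideanSpace.single i (1 : ℝ) := by
    have := (EuclideanSpace.basisFun (Fin m) ℝ).sum_repr w.fst
    simpa using this.symm
  have hw' : w = ∑ i, w.fst i • (WithLp.equiv 2 (EuclideanSpace ℝ (Fin m) × ℝ)).symm
          (EuclideanSpace.single i (1 : ℝ),
            fderiv ℝ u ξ (EuclideanSpace.single i (1 : ℝ))) := by
    apply (WithLp.linearEquiv 2 ℝ (EuclideanSpace ℝ (Fin m) × ℝ)).injective
    rw [map_sum]
    refine Prod.ext ?_ ?_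
    · rw [Prod.fst_sum]
      exact hsum
    · rw [Prod.snd_sum]
      refine hs.trans ?_
      conv_lhs => rw [hsum]
      rw [map_sum]
      exact Finset.sum_congr rfl fun i _ => map_smul _ _ _
  rw [hw']
  exact Submodule.sum_mem _ fun i _ => Submodule.smul_mem _ _ (Submodule.subset_span ⟨i, rfl⟩)
end

section
/- Let m ≥ 1, let B ⊆ ℝ^m be a convex set, λ ≥ 0, L ≥ 0 and ε ≥ 0. Let u : B → ℝ be λ-Lipschitz and let T : B → ℝ^{m+1} be L-Lipschitz with |T(z)| = 1 for every z ∈ B. Fix x ∈ B and let P : ℝ^{m+1} → ℝ^{m+1} denote the orthogonal projection onto the affine hyperplane through the point (x, u(x)) orthogonal to T(x). Then for every y ∈ B and all μ₁, μ₂ ∈ ℝ with |μ₁| ≤ ε and |μ₂| ≤ ε, |P((x, u(x)) + μ₁·T(x)) − P((y, u(y)) + μ₂·T(y))| ≤ (1 + λ + εL)·|x − y|. -/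
open scoped RealInnerProductSpace

theorem aux_proj {E : Type*} [NormedAddCommGroup E] [InnerProductSpace ℝ E] (w t : E)
    (ht : ‖t‖ = 1) : ‖w - ⟪w, t⟫ • t‖ ≤ ‖w‖ := by
  have h : ‖w - ⟪w, t⟫ • t‖ ^ 2 = ‖w‖ ^ 2 - ⟪w, t⟫ ^ 2 := by
    rw [norm_sub_sq_real, inner_smul_right, norm_smul, ht, mul_one, Real.norm_eq_abs, sq_abs]
    ring
  refine abs_le_of_sq_le_sq' ?_ (norm_nonneg w) |>.2
  rw [h]
  nlinarith [sq_nonneg (⟪w, t⟫ : ℝ)]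

theorem aux_gen {E : Type*} [NormedAddCommGroup E] [InnerProductSpace ℝ E] (a b t s : E)
    (μ₁ μ₂ : ℝ) (ht : ‖t‖ = 1) :
    ‖((a + μ₁ • t) - ⟪(a + μ₁ • t) - a, t⟫ • t) - ((b + μ₂ • s) - ⟪(b + μ₂ • s) - a, t⟫ • t)‖
      ≤ ‖a - b‖ + |μ₂| * ‖t - s‖ := by
  have htt : (⟪t, t⟫ : ℝ) = 1 := by rw [real_inner_self_eq_norm_sq, ht]; norm_num
  have e : ((a + μ₁ • t) - ⟪(a + μ₁ • t) - a, t⟫ • t) - ((b + μ₂ • s) - ⟪(b + μ₂ • s) - a, t⟫ • t)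
      = ((a - b) + μ₂ • (t - s)) - ⟪(a - b) + μ₂ • (t - s), t⟫ • t := by
    simp only [inner_add_left, inner_sub_left, real_inner_smul_left, htt]
    module
  rw [e]
  refine (aux_proj _ t ht).trans ((norm_add_le _ _).trans ?_)
  rw [norm_smul, Real.norm_eq_abs]

/-- Projection estimate: with `u : B → ℝ` `λ`-Lipschitz on the convex set
`B`, `T : B → ℝ^{m+1}` an `L`-Lipschitz unit field, `x ∈ B` fixed and `P` the orthogonal
projection onto the affine hyperplane through `(x, u x)` orthogonal to `T x`, one has for all
`y ∈ B` and `|μ₁|, |μ₂| ≤ ε`: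
`|P((x,u x) + μ₁ T x) - P((y,u y) + μ₂ T y)| ≤ (1 + λ + εL) |x - y|`. -/
theorem stmt_16 {m : ℕ} (hm : 1 ≤ m) (B : Set (EuclideanSpace ℝ (Fin m))) (hB : Convex ℝ B)
    (lam L ε : ℝ) (hlam : 0 ≤ lam) (hL : 0 ≤ L) (hε : 0 ≤ ε)
    (u : EuclideanSpace ℝ (Fin m) → ℝ)
    (hu : ∀ z ∈ B, ∀ w ∈ B, |u z - u w| ≤ lam * ‖z - w‖)
    (T : EuclideanSpace ℝ (Fin m) → WithLp 2 (EuclideanSpace ℝ (Fin m) × ℝ))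
    (hTlip : ∀ z ∈ B, ∀ w ∈ B, ‖T z - T w‖ ≤ L * ‖z - w‖)
    (hT1 : ∀ z ∈ B, ‖T z‖ = 1)
    (x : EuclideanSpace ℝ (Fin m)) (hx : x ∈ B)
    (P : WithLp 2 (EuclideanSpace ℝ (Fin m) × ℝ) → WithLp 2 (EuclideanSpace ℝ (Fin m) × ℝ))
    (hP : ∀ z, P z = z -
      ⟪z - (WithLp.equiv 2 (EuclideanSpace ℝ (Fin m) × ℝ)).symm (x, u x), T x⟫ • T x) :
    ∀ y ∈ B, ∀ μ₁ μ₂ : ℝ, |μ₁| ≤ ε → |μ₂| ≤ ε →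
      ‖P ((WithLp.equiv 2 (EuclideanSpace ℝ (Fin m) × ℝ)).symm (x, u x) + μ₁ • T x) -
        P ((WithLp.equiv 2 (EuclideanSpace ℝ (Fin m) × ℝ)).symm (y, u y) + μ₂ • T y)‖ ≤
      (1 + lam + ε * L) * ‖x - y‖ := by
  intro y hy μ₁ μ₂ _ h2
  rw [hP, hP]
  refine (aux_gen _ _ _ _ _ _ (hT1 x hx)).trans ?_
  have h3 : ‖(WithLp.equiv 2 (EuclideanSpace ℝ (Fin m) × ℝ)).symm (x, u x) -
      (WithLp.equiv 2 (EuclideanSpace ℝ (Fin m) × ℝ)).symm (y, u y)‖ ≤ ‖x - y‖ + |u x - u y| := by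
    rw [WithLp.prod_norm_eq_of_L2]
    apply Real.sqrt_le_iff.2
    refine ⟨by positivity, ?_⟩
    change ‖x - y‖ ^ 2 + ‖u x - u y‖ ^ 2 ≤ _
    rw [Real.norm_eq_abs]
    nlinarith [mul_nonneg (norm_nonneg (x - y)) (abs_nonneg (u x - u y))]
  have h4 := hu x hx y hy
  have h5 : |μ₂| * ‖T x - T y‖ ≤ ε * (L * ‖x - y‖) :=
    mul_le_mul h2 (hTlip x hx y hy) (norm_nonneg _) hε
  linarith
end
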